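/- For 0 < α ≤ 1 and functions v, w: I(⟨I^{1−α}(v+w), v+w⟩)(t) ≤ (1 + 1/α)·( I(⟨I^{1−α}v, v⟩)(t) + I(⟨I^{1−α}w, w⟩)(t) ). -/

import Mathlib

open MeasureTheory RealInnerProductSpace

/-- Riemann–Liouville fractional integral of order `β` of an `H`-valued function. -/
noncomputable def fracInt {H : Type*} [NormedAddCommGroup H] [NormedSpace ℝ H]
    (β : ℝ) (v : ℝ → H) (t : ℝ) : H :=
  ∫ s in (0:ℝ)..t, ((t - s) ^ (β - 1) / Real.Gamma β) • v s

lemma aux_conv {H : Type*} [NormedAddCommGroup H] [NormedSpace ℝ H]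
    (k : ℝ → ℝ) (u : ℝ → H) (t s : ℝ) (hs : s ∈ Set.Ioc 0 t) :
    (∫ r in (0:ℝ)..s, k (s - r) • u r)
      = ∫ r, ((Set.Ioc 0 t).indicator k (s - r)) • ((Set.Ioc 0 t).indicator u r) := by
  rw [intervalIntegral.integral_of_le hs.1.le, integral_Ioc_eq_integral_Ioo,
    ← integral_indicator measurableSet_Ioo]
  congr 1
  ext r
  by_cases hr : r ∈ Set.Ioo 0 s
  · have h1 : s - r ∈ Set.Ioc 0 t := ⟨by linarith [hr.2], by linarith [hr.1, hs.2]⟩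
    have h2 : r ∈ Set.Ioc 0 t := ⟨hr.1, by linarith [hr.2, hs.2]⟩
    simp only [Set.indicator_of_mem, hr, h1, h2]
  · rw [Set.indicator_of_notMem hr]
    by_cases h1 : s - r ∈ Set.Ioc 0 t
    · have h2 : r ∉ Set.Ioc 0 t := fun h => hr ⟨h.1, by linarith [h1.1]⟩
      simp only [Set.indicator_of_notMem h2, smul_zero]
    · simp only [Set.indicator_of_notMem h1, zero_smul]

section
variable {H : Type*} [NormedAddCommGroup H] [InnerProductSpace ℝ H]

lemma aux_ind_int (u : ℝ → H) (hu : Continuous u) (t : ℝ) :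
    Integrable ((Set.Ioc 0 t).indicator u) := by
  rw [integrable_indicator_iff measurableSet_Ioc]
  exact (hu.integrableOn_Icc).mono_set Set.Ioc_subset_Icc_self

lemma aux_ind_bd (u : ℝ → H) (hu : Continuous u) (t : ℝ) :
    ∃ C : ℝ, ∀ s, ‖(Set.Ioc 0 t).indicator u s‖ ≤ C := by
  obtain ⟨C, hC⟩ := (isCompact_Icc (a := (0:ℝ)) (b := t)).exists_bound_of_continuousOn
    hu.continuousOn
  refine ⟨max C 0, fun s => ?_⟩
  by_cases hs : s ∈ Set.Ioc 0 t
  · rw [Set.indicator_of_mem hs]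
    exact (hC s (Set.Ioc_subset_Icc_self hs)).trans (le_max_left _ _)
  · rw [Set.indicator_of_notMem hs]; simp

lemma aux_ind_meas (u : ℝ → H) (hu : Continuous u) (t : ℝ) :
    StronglyMeasurable ((Set.Ioc 0 t).indicator u) :=
  hu.stronglyMeasurable.indicator measurableSet_Ioc

lemma aux_smul_int (k : ℝ → ℝ) (t : ℝ) (hk : IntegrableOn k (Set.Ioc 0 t))
    (u : ℝ → H) (hu : Continuous u) :
    Integrable (fun p : ℝ × ℝ => ((Set.Ioc 0 t).indicator k (p.1 - p.2)) •
      ((Set.Ioc 0 t).indicator u p.2)) (volume.prod volume) := by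
  have h1 : Integrable ((Set.Ioc 0 t).indicator k) := by
    rwa [integrable_indicator_iff measurableSet_Ioc]
  have := (aux_ind_int u hu t).convolution_integrand (ContinuousLinearMap.lsmul ℝ ℝ).flip h1
  simpa using this

lemma aux_int (k : ℝ → ℝ) (t : ℝ) (hk : IntegrableOn k (Set.Ioc 0 t))
    (u w : ℝ → H) (hu : Continuous u) (hw : Continuous w) :
    Integrable (fun p : ℝ × ℝ => ((Set.Ioc 0 t).indicator k (p.1 - p.2)) *
      ⟪(Set.Ioc 0 t).indicator u p.2, (Set.Ioc 0 t).indicator w p.1⟫) (volume.prod volume) := by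
  obtain ⟨C, hC⟩ := aux_ind_bd w hw t
  have h1 := aux_smul_int k t hk u hu
  have h2 : StronglyMeasurable (fun p : ℝ × ℝ => (Set.Ioc 0 t).indicator w p.1) :=
    (aux_ind_meas w hw t).comp_measurable measurable_fst
  refine (h1.norm.mul_const C).mono' ?_ ?_
  · refine (h1.aestronglyMeasurable.inner (𝕜 := ℝ) h2.aestronglyMeasurable).congr ?_
    refine Filter.Eventually.of_forall fun p => ?_
    simp only [real_inner_smul_left]
  · refine Filter.Eventually.of_forall fun p => ?_
    rw [← real_inner_smul_left]
    exact (norm_inner_le_norm _ _).trans (by gcongr; exact hC _)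

variable [CompleteSpace H]

lemma aux_eq (k : ℝ → ℝ) (t : ℝ) (ht : 0 < t) (hk : IntegrableOn k (Set.Ioc 0 t))
    (u w : ℝ → H) (hu : Continuous u) (hw : Continuous w) :
    (∫ s in (0:ℝ)..t, ⟪∫ r in (0:ℝ)..s, k (s - r) • u r, w s⟫)
      = ∫ p : ℝ × ℝ, ((Set.Ioc 0 t).indicator k (p.1 - p.2)) *
      ⟪(Set.Ioc 0 t).indicator u p.2, (Set.Ioc 0 t).indicator w p.1⟫ ∂(volume.prod volume) := by
  rw [integral_prod _ (aux_int k t hk u w hu hw), intervalIntegral.integral_of_le ht.le,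
    ← integral_indicator measurableSet_Ioc]
  refine integral_congr_ae ?_
  filter_upwards [(aux_smul_int k t hk u hu).prod_right_ae] with s hs
  by_cases h : s ∈ Set.Ioc 0 t
  · simp only [Set.indicator_of_mem h]
    rw [aux_conv k u t s h, real_inner_comm, ← integral_inner hs]
    congr 1
    ext r
    rw [real_inner_smul_right, real_inner_comm]
  · simp only [Set.indicator_of_notMem h, inner_zero_right, mul_zero, integral_zero]

lemma aux_exp (l : ℝ) (hl : 0 < l) (t : ℝ) (ht : 0 < t) (u : ℝ → H) (hu : Continuous u) :
    0 ≤ ∫ s in (0:ℝ)..t, ⟪∫ r in (0:ℝ)..s, Real.exp (-(l * (s - r))) • u r, u s⟫ := by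
  set y : ℝ → H := fun s => ∫ r in (0:ℝ)..s, Real.exp (-(l * (s - r))) • u r with hy
  have hc : Continuous (fun r => Real.exp (l * r) • u r) := by fun_prop
  have hy2 : y = fun s => Real.exp (-(l * s)) • ∫ r in (0:ℝ)..s, Real.exp (l * r) • u r := by
    ext s
    rw [hy, ← intervalIntegral.integral_smul]
    refine intervalIntegral.integral_congr fun r _ => ?_
    rw [smul_smul, ← Real.exp_add]
    congr 2
    ring
  have hd : ∀ s, HasDerivAt y (-l • y s + u s) s := by
    intro s
    have h1 : HasDerivAt (fun s => ∫ r in (0:ℝ)..s, Real.exp (l * r) • u r)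
        (Real.exp (l * s) • u s) s :=
      intervalIntegral.integral_hasDerivAt_right (hc.intervalIntegrable _ _)
        (hc.stronglyMeasurableAtFilter _ _) hc.continuousAt
    have h2 : HasDerivAt (fun s => Real.exp (-(l * s))) (Real.exp (-(l * s)) * (-(l * 1))) s :=
      (((hasDerivAt_id s).const_mul l).neg).exp
    have h3 := h2.smul h1
    rw [hy2]
    refine h3.congr_deriv ?_
    rw [smul_smul, ← Real.exp_add, smul_smul]
    simp only [neg_add_cancel, Real.exp_zero, one_smul]
    rw [add_comm]
    congr 2
    ring
  have hyc : Continuous y := continuous_iff_continuousAt.2 fun s => (hd s).continuousAt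
  have hF : ∀ s, HasDerivAt (fun s => ⟪y s, y s⟫ / 2) (⟪y s, u s⟫ - l * ⟪y s, y s⟫) s := by
    intro s
    refine (((hd s).inner ℝ (hd s)).div_const 2).congr_deriv ?_
    simp only [inner_add_left, inner_add_right, real_inner_smul_left, real_inner_smul_right]
    rw [real_inner_comm (y s) (u s)]
    ring
  have hci : Continuous (fun s => ⟪y s, u s⟫) := hyc.inner hu
  have hcy : Continuous (fun s => l * ⟪y s, y s⟫) := (hyc.inner hyc).const_mul l |> fun h => h
  have h4 := intervalIntegral.integral_eq_sub_of_hasDerivAt (a := 0) (b := t) (fun s _ => hF s)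
    ((hci.sub hcy).intervalIntegrable _ _)
  rw [intervalIntegral.integral_sub (hci.intervalIntegrable _ _) (hcy.intervalIntegrable _ _)] at h4
  have h0 : y 0 = 0 := by simp [hy]
  have h5 : 0 ≤ ∫ s in (0:ℝ)..t, l * ⟪y s, y s⟫ :=
    intervalIntegral.integral_nonneg ht.le fun s _ => mul_nonneg hl.le real_inner_self_nonneg
  have h6 : 0 ≤ ⟪y t, y t⟫ := real_inner_self_nonneg
  rw [h0, inner_zero_left] at h4
  change 0 ≤ ∫ s in (0:ℝ)..t, ⟪y s, u s⟫
  linarith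

lemma aux_pow_int (a : ℝ) (ha1 : a < 1) (t : ℝ) (ht : 0 < t) :
    IntegrableOn (fun x : ℝ => x ^ (-a)) (Set.Ioc 0 t) := by
  have := intervalIntegral.intervalIntegrable_rpow' (a := 0) (b := t) (r := -a) (by linarith)
  rwa [intervalIntegrable_iff_integrableOn_Ioc_of_le ht.le] at this

lemma aux_lap (a : ℝ) (ha : 0 < a) (x : ℝ) (hx : 0 < x) :
    (∫ l in Set.Ioi (0:ℝ), l ^ (a - 1) * Real.exp (-(l * x))) = Real.Gamma a * x ^ (-a) := by
  have := Real.integral_rpow_mul_exp_neg_mul_Ioi ha hx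
  simp_rw [mul_comm x] at this
  rw [this, one_div, Real.inv_rpow hx.le, Real.rpow_neg hx.le, mul_comm]

lemma aux_lap_int (a : ℝ) (ha : 0 < a) (x : ℝ) (hx : 0 < x) :
    IntegrableOn (fun l : ℝ => l ^ (a - 1) * Real.exp (-(l * x))) (Set.Ioi 0) := by
  by_contra h
  have h1 := aux_lap a ha x hx
  rw [integral_undef h] at h1
  have := Real.Gamma_pos_of_pos ha
  have := Real.rpow_pos_of_pos hx (-a)
  exact absurd h1 (by positivity)

lemma aux_nonneg (a : ℝ) (ha : 0 < a) (ha1 : a < 1) (t : ℝ) (ht : 0 < t)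
    (u : ℝ → H) (hu : Continuous u) :
    0 ≤ ∫ p : ℝ × ℝ, ((Set.Ioc 0 t).indicator (fun x => x ^ (-a)) (p.1 - p.2)) *
      ⟪(Set.Ioc 0 t).indicator u p.2, (Set.Ioc 0 t).indicator u p.1⟫ ∂(volume.prod volume) := by
  set f := (Set.Ioc 0 t).indicator u with hf
  have hfm : StronglyMeasurable f := aux_ind_meas u hu t
  have hG := Real.Gamma_pos_of_pos ha
  -- the three variable integrand
  let F : (ℝ × ℝ) → ℝ → ℝ := fun p l =>
    (l ^ (a - 1) * (Set.Ioc 0 t).indicator (fun x => Real.exp (-(l * x))) (p.1 - p.2))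
      * ⟪f p.2, f p.1⟫
  have hFm : StronglyMeasurable (Function.uncurry F) := by
    have h1 : StronglyMeasurable (fun q : (ℝ × ℝ) × ℝ => ⟪f q.1.2, f q.1.1⟫) :=
      (hfm.comp_measurable (measurable_snd.comp measurable_fst)).inner
        (hfm.comp_measurable (measurable_fst.comp measurable_fst))
    have h2 : Measurable (fun q : (ℝ × ℝ) × ℝ => q.2 ^ (a - 1) *
        (Set.Ioc 0 t).indicator (fun x => Real.exp (-(q.2 * x))) (q.1.1 - q.1.2)) := by
      refine (measurable_snd.pow_const _).mul ?_
      have : (fun q : (ℝ × ℝ) × ℝ => 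
        (Set.Ioc 0 t).indicator (fun x => Real.exp (-(q.2 * x))) (q.1.1 - q.1.2))
        = ((fun q : (ℝ × ℝ) × ℝ => q.1.1 - q.1.2) ⁻¹' (Set.Ioc 0 t)).indicator
          (fun q => Real.exp (-(q.2 * (q.1.1 - q.1.2)))) := by
        ext q; simp [Set.indicator]
      rw [this]
      refine Measurable.indicator (by fun_prop) ?_
      exact (by fun_prop : Measurable (fun q : (ℝ × ℝ) × ℝ => q.1.1 - q.1.2)) measurableSet_Ioc
    exact h2.stronglyMeasurable.mul h1
  have hFi : ∀ p, Integrable (F p) (volume.restrict (Set.Ioi 0)) := by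
    intro p
    by_cases h : p.1 - p.2 ∈ Set.Ioc 0 t
    · simp only [F, Set.indicator_of_mem h]
      exact (aux_lap_int a ha _ h.1).mul_const _
    · simp only [F, Set.indicator_of_notMem h, mul_zero, zero_mul]
      exact integrable_zero _ _ _
  have hFint : ∀ p, (∫ l in Set.Ioi (0:ℝ), F p l) = Real.Gamma a *
      (((Set.Ioc 0 t).indicator (fun x => x ^ (-a)) (p.1 - p.2)) * ⟪f p.2, f p.1⟫) := by
    intro p
    by_cases h : p.1 - p.2 ∈ Set.Ioc 0 t
    · simp only [F, Set.indicator_of_mem h]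
      rw [integral_mul_const, aux_lap a ha _ h.1]
      ring
    · simp only [F, Set.indicator_of_notMem h, mul_zero, zero_mul, integral_zero]
  have hFnorm : ∀ p, (∫ l in Set.Ioi (0:ℝ), ‖F p l‖) = ‖∫ l in Set.Ioi (0:ℝ), F p l‖ := by
    intro p
    have e : ∀ l, F p l = (l ^ (a - 1) *
      (Set.Ioc 0 t).indicator (fun x => Real.exp (-(l * x))) (p.1 - p.2)) * ⟪f p.2, f p.1⟫ :=
      fun l => rfl
    have hn : ∀ l ∈ Set.Ioi (0:ℝ), 0 ≤ l ^ (a - 1) *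
      (Set.Ioc 0 t).indicator (fun x => Real.exp (-(l * x))) (p.1 - p.2) := fun l hl =>
      mul_nonneg (Real.rpow_nonneg (le_of_lt hl) _)
        (Set.indicator_nonneg (fun x _ => (Real.exp_pos _).le) _)
    simp_rw [e, norm_mul _ ⟪f p.2, f p.1⟫]
    rw [integral_mul_const, integral_mul_const, norm_mul,
      Real.norm_of_nonneg (setIntegral_nonneg measurableSet_Ioi hn)]
    congr 1
    exact setIntegral_congr_fun measurableSet_Ioi fun l hl => Real.norm_of_nonneg (hn l hl)
  have hI := aux_int (fun x => x ^ (-a)) t (aux_pow_int a ha1 t ht) u u hu hu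
  have hF3 : Integrable (Function.uncurry F)
      ((volume.prod volume).prod (volume.restrict (Set.Ioi 0))) := by
    rw [integrable_prod_iff hFm.aestronglyMeasurable]
    refine ⟨Filter.Eventually.of_forall hFi, ?_⟩
    simp only [Function.uncurry]
    simp_rw [hFnorm, hFint]
    exact (hI.const_mul _).norm
  have hsw := integral_integral_swap hF3
  simp_rw [hFint] at hsw
  rw [integral_const_mul] at hsw
  have hR : 0 ≤ ∫ l in Set.Ioi (0:ℝ), ∫ p, F p l ∂((volume : Measure ℝ).prod volume) := by
    refine setIntegral_nonneg measurableSet_Ioi fun l hl => ?_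
    have hE := aux_exp l hl t ht u hu
    have hk : IntegrableOn (fun x => Real.exp (-(l * x))) (Set.Ioc 0 t) :=
      (Continuous.integrableOn_Icc (by fun_prop)).mono_set Set.Ioc_subset_Icc_self
    rw [aux_eq (fun x => Real.exp (-(l * x))) t ht hk u u hu hu] at hE
    simp only [F, mul_assoc]
    rw [integral_const_mul]
    exact mul_nonneg (Real.rpow_nonneg (le_of_lt hl) _) hE
  rw [← hsw] at hR
  exact nonneg_of_mul_nonneg_right hR hG

end

/-- `I(⟨I^{1-α}(v+w), v+w⟩)(t) ≤ (1 + 1/α) (I(⟨I^{1-α}v,v⟩)(t) + I(⟨I^{1-α}w,w⟩)(t))`. -/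
theorem fracInt_quadratic_add_bound {H : Type*} [NormedAddCommGroup H]
    [InnerProductSpace ℝ H] [CompleteSpace H]
    (α : ℝ) (hα : 0 < α) (hα1 : α ≤ 1) (t : ℝ) (ht : 0 < t)
    (v w : ℝ → H) (hv : Continuous v) (hw : Continuous w) :
    (∫ s in (0:ℝ)..t, ⟪fracInt (1 - α) (fun r => v r + w r) s, v s + w s⟫)
      ≤ (1 + 1 / α) * ((∫ s in (0:ℝ)..t, ⟪fracInt (1 - α) v s, v s⟫)
          + ∫ s in (0:ℝ)..t, ⟪fracInt (1 - α) w s, w s⟫) := by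
  rcases hα1.eq_or_lt with h1 | h1
  · subst h1
    simp [fracInt, Real.Gamma_zero]
  set I := Set.Ioc 0 t with hI
  let B : (ℝ → H) → (ℝ → H) → ℝ × ℝ → ℝ := fun x y p =>
    (I.indicator (fun x => x ^ (-α)) (p.1 - p.2)) * ⟪I.indicator x p.2, I.indicator y p.1⟫
  have hk := aux_pow_int α h1 t ht
  have key : ∀ x : ℝ → H, Continuous x → (∫ s in (0:ℝ)..t, ⟪fracInt (1 - α) x s, x s⟫)
      = (Real.Gamma (1 - α))⁻¹ * ∫ p, B x x p ∂(volume.prod volume) := by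
    intro x hx
    have := aux_eq (fun x => x ^ (-α)) t ht hk x x hx hx
    rw [← this, ← intervalIntegral.integral_const_mul]
    congr 1
    ext s
    rw [← real_inner_smul_left, ← intervalIntegral.integral_smul]
    unfold fracInt
    congr 1
    refine intervalIntegral.integral_congr fun r _ => ?_
    rw [smul_smul, div_eq_inv_mul]
    congr 3
    ring
  have hBi : ∀ x y : ℝ → H, Continuous x → Continuous y →
      Integrable (B x y) (volume.prod volume) := fun x y hx hy =>
    aux_int (fun x => x ^ (-α)) t hk x y hx hy
  have par : (∫ p, B (v + w) (v + w) p ∂(volume.prod volume))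
      + (∫ p, B (v - w) (v - w) p ∂(volume.prod volume))
      = 2 * ((∫ p, B v v p ∂(volume.prod volume)) + ∫ p, B w w p ∂(volume.prod volume)) := by
    rw [← integral_add (hBi _ _ (hv.add hw) (hv.add hw)) (hBi _ _ (hv.sub hw) (hv.sub hw)),
      ← integral_add (hBi _ _ hv hv) (hBi _ _ hw hw), ← integral_const_mul]
    congr 1
    ext p
    simp only [B, Set.indicator_add', Set.indicator_sub', Pi.add_apply, Pi.sub_apply,
      inner_add_left, inner_add_right, inner_sub_left, inner_sub_right]
    ring
  have n1 : 0 ≤ ∫ p, B (v - w) (v - w) p ∂(volume.prod volume) :=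
    aux_nonneg α hα h1 t ht _ (hv.sub hw)
  have n2 : 0 ≤ ∫ p, B v v p ∂(volume.prod volume) := aux_nonneg α hα h1 t ht _ hv
  have n3 : 0 ≤ ∫ p, B w w p ∂(volume.prod volume) := aux_nonneg α hα h1 t ht _ hw
  have hG : 0 < (Real.Gamma (1 - α))⁻¹ := inv_pos.2 (Real.Gamma_pos_of_pos (by linarith))
  have e1 := key (v + w) (hv.add hw)
  simp only [Pi.add_apply] at e1
  change (∫ s in (0:ℝ)..t, ⟪fracInt (1 - α) (v + w) s, v s + w s⟫) ≤ _
  rw [e1, key v hv, key w hw, ← mul_add, mul_left_comm]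
  refine mul_le_mul_of_nonneg_left ?_ hG.le
  have h2 : 2 ≤ 1 + 1 / α := by
    have : 1 ≤ 1 / α := by rw [le_div_iff₀ hα]; linarith
    linarith
  nlinarith [mul_le_mul_of_nonneg_right h2 (add_nonneg n2 n3)]
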